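/- For every k ∈ ℕ there exists a constant c_k > 0 such that for all d ∈ ℕ and all ε ∈ (0, 1/2) the information complexity of integration on F^k_d satisfies n(ε, F^k_d) ≥ ( c_k · d / ε )^{d/k}. In particular, numerical integration on the classes F^k_d suffers from the curse of dimensionality. -/

import Mathlib

open MeasureTheory

/-- Iterated partial derivative in coordinate direction `i`. -/
noncomputable def pderiv' (d : ℕ) (i : Fin d) (f : (Fin d → ℝ) → ℝ) : (Fin d → ℝ) → ℝ :=
  fun x => fderiv ℝ f x (Pi.single i 1)

/-- The partial derivative `D^α f` for a multi-index `α`. -/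
noncomputable def mderiv (d : ℕ) (α : Fin d → ℕ) (f : (Fin d → ℝ) → ℝ) : (Fin d → ℝ) → ℝ :=
  ((List.finRange d).flatMap fun i => List.replicate (α i) i).foldr (pderiv' d) f

/-- The open unit cube `(0,1)^d`. -/
def unitCube (d : ℕ) : Set (Fin d → ℝ) := Set.univ.pi fun _ => Set.Ioo 0 1

/-- The class `F^k_d(D)` of `C^k` functions with all partial derivatives of order `≤ k`
bounded by one on `D`. -/
def Fkd (k d : ℕ) (D : Set (Fin d → ℝ)) : Set ((Fin d → ℝ) → ℝ) :=
  { f | ContDiffOn ℝ k f D ∧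
      ∀ α : Fin d → ℕ, (∑ i, α i) ≤ k → ∀ x ∈ D, |mderiv d α f x| ≤ 1 }

/-- The `n`-th minimal worst-case error of numerical integration on the class `F` over `D`:
`e(n,F) = inf_{x₁,…,xₙ ∈ D} sup{ ∫_D f : f ∈ F, f(x₁) = ⋯ = f(xₙ) = 0 }`. -/
noncomputable def interr {d : ℕ} (D : Set (Fin d → ℝ))
    (F : Set ((Fin d → ℝ) → ℝ)) (n : ℕ) : ℝ :=
  ⨅ x : Fin n → D, sSup ((fun f => ∫ t in D, f t) ''
    {f | f ∈ F ∧ ∀ i, f ((x i : Fin d → ℝ)) = 0})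

open scoped Convolution ContDiff

/-- Tensor product of the iterated derivatives of a one-variable kernel. -/
noncomputable def tensorDeriv {d : ℕ} (φ : ℝ → ℝ) (β : Fin d → ℕ) (x : Fin d → ℝ) : ℝ :=
  ∏ i, iteratedDeriv (β i) φ (x i)

/-- Smooth compactly supported kernels at every scale, with scale-explicit `L¹` bounds on
their derivatives. -/
theorem exists_kernel (k : ℕ) :
    ∃ M : ℝ, 1 ≤ M ∧ ∀ δ : ℝ, 0 < δ → ∃ φ : ℝ → ℝ, ContDiff ℝ ∞ φ ∧ HasCompactSupport φ ∧
      (∀ x, φ x ≠ 0 → |x| ≤ δ) ∧ (∀ x, 0 ≤ φ x) ∧ ∫ x, φ x = 1 ∧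
      ∀ j ≤ k, ∫ x, |iteratedDeriv j φ x| ≤ (M / δ) ^ j := by
  let b : ContDiffBump (0 : ℝ) := ⟨1 / 2, 1, by norm_num, by norm_num⟩
  set ψ : ℝ → ℝ := b.normed volume with hψ
  have hψs : ContDiff ℝ ∞ ψ := b.contDiff_normed
  have hψi : ∫ x, ψ x = 1 := b.integral_normed
  have hψ0 : ∀ x, 0 ≤ ψ x := b.nonneg_normed
  set M : ℝ := 1 + ∑ j ∈ Finset.range (k + 1), ∫ x, |iteratedDeriv j ψ x| with hM
  have hnn : ∀ j, 0 ≤ ∫ x, |iteratedDeriv j ψ x| := fun j => by positivity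
  have hM1 : 1 ≤ M := le_add_of_nonneg_right (Finset.sum_nonneg fun j _ => hnn j)
  have hMj : ∀ j ≤ k, ∫ x, |iteratedDeriv j ψ x| ≤ M := fun j hj =>
    (Finset.single_le_sum (f := fun j => ∫ x, |iteratedDeriv j ψ x|) (fun j _ => hnn j)
      (Finset.mem_range.2 (Nat.lt_succ_of_le hj))).trans (by rw [hM]; linarith)
  refine ⟨M, hM1, fun δ hδ => ⟨fun x => δ⁻¹ * ψ (δ⁻¹ * x), ?_, ?_, ?_, ?_, ?_, ?_⟩⟩
  · exact contDiff_const.mul (hψs.comp (contDiff_const.mul contDiff_id))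
  · have h := b.hasCompactSupport_normed (μ := volume)
    exact (h.comp_homeomorph (Homeomorph.mulLeft₀ δ⁻¹ (inv_ne_zero hδ.ne'))).mul_left
  · intro x hx
    have h1 : ψ (δ⁻¹ * x) ≠ 0 := right_ne_zero_of_mul hx
    have h2 : δ⁻¹ * x ∈ Metric.ball (0 : ℝ) b.rOut := by
      rw [← b.support_normed_eq (μ := volume)]; exact h1
    have h3 : |δ⁻¹ * x| < 1 := by simpa [Real.norm_eq_abs] using h2
    rw [abs_mul, abs_of_pos (inv_pos.2 hδ), inv_mul_lt_iff₀ hδ] at h3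
    linarith
  · intro x
    exact mul_nonneg (inv_nonneg.2 hδ.le) (hψ0 _)
  · rw [integral_const_mul, Measure.integral_comp_mul_left, hψi]
    simp [abs_of_pos hδ, hδ.ne']
  · intro j hj
    have hj' : ContDiff ℝ (j : ℕ) ψ := hψs.of_le (by exact_mod_cast le_top)
    have h : ∀ x, |iteratedDeriv j (fun x => δ⁻¹ * ψ (δ⁻¹ * x)) x|
        = δ⁻¹ ^ j * δ⁻¹ * |iteratedDeriv j ψ (δ⁻¹ * x)| := by
      intro x
      rw [iteratedDeriv_const_mul_field, iteratedDeriv_comp_const_mul hj', abs_mul, abs_mul,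
        abs_of_pos (inv_pos.2 hδ), abs_of_pos (pow_pos (inv_pos.2 hδ) j)]
      ring
    simp_rw [h]
    rw [integral_const_mul, Measure.integral_comp_mul_left (fun x => |iteratedDeriv j ψ x|),
      inv_inv, abs_of_pos hδ, smul_eq_mul, div_eq_mul_inv, mul_pow]
    have : δ⁻¹ ^ j * δ⁻¹ * (δ * ∫ x, |iteratedDeriv j ψ x|)
        = (∫ x, |iteratedDeriv j ψ x|) * δ⁻¹ ^ j := by field_simp
    rw [this]
    refine mul_le_mul_of_nonneg_right ?_ (by positivity)
    rcases Nat.eq_zero_or_pos j with rfl | hj0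
    · simp [abs_of_nonneg (hψ0 _), hψi]
    · exact (hMj j hj).trans (le_self_pow₀ hM1 hj0.ne')

section Kernel

variable {d : ℕ} {φ : ℝ → ℝ}

theorem contDiff_iteratedDeriv_of_infty (hφ : ContDiff ℝ ∞ φ) (j : ℕ) :
    ContDiff ℝ ∞ (iteratedDeriv j φ) := by
  rw [iteratedDeriv_eq_iterate]
  exact hφ.iterate_deriv j

theorem hasCompactSupport_iteratedDeriv (hc : HasCompactSupport φ) (j : ℕ) :
    HasCompactSupport (iteratedDeriv j φ) := by
  induction j with
  | zero => simpa using hc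
  | succ j ih => rw [iteratedDeriv_succ]; exact ih.deriv

theorem contDiff_tensorDeriv (hφ : ContDiff ℝ ∞ φ) (β : Fin d → ℕ) :
    ContDiff ℝ ∞ (tensorDeriv φ β) :=
  contDiff_prod fun i _ => (contDiff_iteratedDeriv_of_infty hφ (β i)).comp (contDiff_apply ℝ ℝ i)

theorem hasCompactSupport_tensorDeriv (hc : HasCompactSupport φ) (β : Fin d → ℕ) :
    HasCompactSupport (tensorDeriv φ β) := by
  refine HasCompactSupport.intro (K := Set.univ.pi fun i => tsupport (iteratedDeriv (β i) φ))
    (isCompact_univ_pi fun i => hasCompactSupport_iteratedDeriv hc (β i)) fun x hx => ?_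
  obtain ⟨i, hi⟩ : ∃ i, x i ∉ tsupport (iteratedDeriv (β i) φ) := by simpa using hx
  exact Finset.prod_eq_zero (Finset.mem_univ i) (image_eq_zero_of_notMem_tsupport hi)

theorem pderiv'_tensorDeriv (hφ : ContDiff ℝ ∞ φ) (β : Fin d → ℕ) (i : Fin d) :
    pderiv' d i (tensorDeriv φ β) = tensorDeriv φ (β + Pi.single i 1) := by
  funext x
  have h : HasFDerivAt (tensorDeriv φ β) (∑ j, (∏ l ∈ Finset.univ.erase j,
      iteratedDeriv (β l) φ (x l)) • (iteratedDeriv (β j + 1) φ (x j) •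
        (ContinuousLinearMap.proj j : (Fin d → ℝ) →L[ℝ] ℝ))) x := by
    refine HasFDerivAt.finsetProd fun j _ => ?_
    have h1 : HasDerivAt (iteratedDeriv (β j) φ) (iteratedDeriv (β j + 1) φ (x j)) (x j) := by
      rw [iteratedDeriv_succ]
      exact ((contDiff_iteratedDeriv_of_infty hφ (β j)).differentiable
        (by simp)).differentiableAt.hasDerivAt
    exact HasDerivAt.comp_hasFDerivAt (f := fun y : Fin d → ℝ => y j) x h1 (hasFDerivAt_apply j x)
  rw [pderiv', h.fderiv, tensorDeriv, ← Finset.mul_prod_erase _ _ (Finset.mem_univ i)]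
  rw [sum_apply, Finset.sum_eq_single i]
  · simp only [smul_apply, ContinuousLinearMap.proj_apply, Pi.single_eq_same, Pi.add_apply,
      smul_eq_mul, mul_one]
    rw [mul_comm]
    congr 1
    refine Finset.prod_congr rfl fun l hl => ?_
    simp [Pi.single_eq_of_ne (Finset.ne_of_mem_erase hl)]
  · intro j _ hj
    simp [Pi.single_eq_of_ne hj]
  · simp

theorem integrable_tensorDeriv (hφ : ContDiff ℝ ∞ φ) (hc : HasCompactSupport φ)
    (β : Fin d → ℕ) : Integrable (tensorDeriv φ β) :=
  (contDiff_tensorDeriv hφ β).continuous.integrable_of_hasCompactSupport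
    (hasCompactSupport_tensorDeriv hc β)

theorem integral_abs_tensorDeriv (β : Fin d → ℕ) :
    ∫ x, |tensorDeriv φ β x| = ∏ i, ∫ t, |iteratedDeriv (β i) φ t| := by
  simp_rw [tensorDeriv, Finset.abs_prod]
  exact integral_fintype_prod_volume_eq_prod fun i t => |iteratedDeriv (β i) φ t|

/-- Convolution of `u` with a derivative of the tensor kernel. -/
noncomputable def smoothing (u : (Fin d → ℝ) → ℝ) (φ : ℝ → ℝ) (β : Fin d → ℕ) :
    (Fin d → ℝ) → ℝ :=
  u ⋆[ContinuousLinearMap.lsmul ℝ ℝ, volume] tensorDeriv φ β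

theorem smoothing_apply (u : (Fin d → ℝ) → ℝ) (β : Fin d → ℕ) (x : Fin d → ℝ) :
    smoothing u φ β x = ∫ t, u (x - t) * tensorDeriv φ β t := by
  rw [smoothing, convolution_eq_swap]
  rfl

variable {u : (Fin d → ℝ) → ℝ}

theorem integrable_smoothing (hu : Continuous u) (hφ : ContDiff ℝ ∞ φ)
    (hc : HasCompactSupport φ) (β : Fin d → ℕ) (x : Fin d → ℝ) :
    Integrable fun t => u (x - t) * tensorDeriv φ β t :=
  Continuous.integrable_of_hasCompactSupport
    ((hu.comp (continuous_const.sub continuous_id)).mul (contDiff_tensorDeriv hφ β).continuous)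
    (hasCompactSupport_tensorDeriv hc β).mul_left

theorem contDiff_smoothing (hu : Continuous u) (hφ : ContDiff ℝ ∞ φ)
    (hc : HasCompactSupport φ) (β : Fin d → ℕ) : ContDiff ℝ ∞ (smoothing u φ β) :=
  (hasCompactSupport_tensorDeriv hc β).contDiff_convolution_right _ hu.locallyIntegrable
    (contDiff_tensorDeriv hφ β)

theorem pderiv'_smoothing (hu : Continuous u) (hφ : ContDiff ℝ ∞ φ)
    (hc : HasCompactSupport φ) (β : Fin d → ℕ) (i : Fin d) :
    pderiv' d i (smoothing u φ β) = smoothing u φ (β + Pi.single i 1) := by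
  funext x
  have hK := hasCompactSupport_tensorDeriv hc β
  have hs : ContDiff ℝ 1 (tensorDeriv φ β) :=
    (contDiff_tensorDeriv hφ β).of_le (by exact_mod_cast le_top)
  have h := hK.hasFDerivAt_convolution_right (ContinuousLinearMap.lsmul ℝ ℝ)
    (hu.locallyIntegrable (μ := volume)) hs x
  rw [pderiv', smoothing, h.fderiv, convolution_precompR_apply _ hu.locallyIntegrable
    (hK.fderiv ℝ) (hs.continuous_fderiv one_ne_zero), smoothing, ← pderiv'_tensorDeriv hφ]
  rfl

theorem foldr_pderiv'_smoothing (hu : Continuous u) (hφ : ContDiff ℝ ∞ φ)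
    (hc : HasCompactSupport φ) (l : List (Fin d)) :
    l.foldr (pderiv' d) (smoothing u φ 0) = smoothing u φ fun i => l.count i := by
  induction l with
  | nil => simp; rfl
  | cons i l ih =>
    rw [List.foldr_cons, ih, pderiv'_smoothing hu hφ hc]
    congr 1
    funext j
    by_cases h : i = j
    · subst h; simp
    · simp [h]

theorem abs_pderiv'_smoothing_le (hu : Continuous u) (hφ : ContDiff ℝ ∞ φ)
    (hc : HasCompactSupport φ) {L : ℝ} (hL : 0 ≤ L)
    (hLip : ∀ x i s, |u (x + s • Pi.single i 1) - u x| ≤ L * |s|)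
    (β : Fin d → ℕ) (i : Fin d) (x : Fin d → ℝ) :
    |pderiv' d i (smoothing u φ β) x| ≤ L * ∏ j, ∫ t, |iteratedDeriv (β j) φ t| := by
  have hd : HasLineDerivAt ℝ (smoothing u φ β) (pderiv' d i (smoothing u φ β) x) x
      (Pi.single i 1) :=
    ((contDiff_smoothing hu hφ hc β).differentiable
      (by simp)).differentiableAt.hasFDerivAt.hasLineDerivAt _
  rw [← integral_abs_tensorDeriv]
  refine HasDerivAt.le_of_lip' hd (mul_nonneg hL (by positivity)) (.of_forall fun s => ?_)
  simp only [zero_smul, add_zero, sub_zero, smoothing_apply, Real.norm_eq_abs]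
  rw [← integral_sub (integrable_smoothing hu hφ hc β _) (integrable_smoothing hu hφ hc β _)]
  have hI := (integrable_tensorDeriv hφ hc β).abs
  calc |∫ t, (u (x + s • Pi.single i 1 - t) * tensorDeriv φ β t - u (x - t) * tensorDeriv φ β t)|
      ≤ ∫ t, L * |s| * |tensorDeriv φ β t| := by
        rw [← Real.norm_eq_abs]
        refine norm_integral_le_of_norm_le (hI.const_mul _) (.of_forall fun t => ?_)
        rw [← sub_mul, norm_mul, Real.norm_eq_abs, Real.norm_eq_abs]
        refine mul_le_mul_of_nonneg_right ?_ (abs_nonneg _)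
        rw [add_sub_right_comm]
        exact hLip _ _ _
    _ = L * (∫ t, |tensorDeriv φ β t|) * |s| := by rw [integral_const_mul]; ring

end Kernel

section Smoothing

variable {d : ℕ} {φ : ℝ → ℝ} {u : (Fin d → ℝ) → ℝ}

theorem tensorDeriv_zero_apply (x : Fin d → ℝ) : tensorDeriv φ 0 x = ∏ i, φ (x i) := by
  simp [tensorDeriv]

theorem integral_tensorDeriv_zero (h1 : ∫ x, φ x = 1) :
    ∫ x : Fin d → ℝ, tensorDeriv φ 0 x = 1 := by
  simp_rw [tensorDeriv_zero_apply]
  rw [integral_fintype_prod_volume_eq_prod fun _ : Fin d => φ]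
  simp [h1]

theorem smoothing_zero_eq_of_forall {δ c : ℝ} (hsupp : ∀ x, φ x ≠ 0 → |x| ≤ δ)
    (h1 : ∫ x, φ x = 1) {x : Fin d → ℝ} (h : ∀ t : Fin d → ℝ, (∀ i, |t i| ≤ δ) → u (x - t) = c) :
    smoothing u φ 0 x = c := by
  rw [smoothing_apply]
  calc ∫ t, u (x - t) * tensorDeriv φ 0 t = ∫ t : Fin d → ℝ, c * tensorDeriv φ 0 t := by
        congr 1
        funext t
        by_cases ht : tensorDeriv φ 0 t = 0
        · simp [ht]
        · rw [h t fun i => hsupp _ fun h0 => ht ?_]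
          rw [tensorDeriv_zero_apply]
          exact Finset.prod_eq_zero (Finset.mem_univ i) h0
    _ = c := by rw [integral_const_mul, integral_tensorDeriv_zero h1, mul_one]

theorem smoothing_zero_nonneg (hφ0 : ∀ x, 0 ≤ φ x) (hu : ∀ x, 0 ≤ u x) (x : Fin d → ℝ) :
    0 ≤ smoothing u φ 0 x := by
  rw [smoothing_apply]
  refine integral_nonneg fun t => mul_nonneg (hu _) ?_
  rw [tensorDeriv_zero_apply]
  exact Finset.prod_nonneg fun i _ => hφ0 _

theorem smoothing_zero_le {c : ℝ} (hφ : ContDiff ℝ ∞ φ) (hc : HasCompactSupport φ)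
    (hφ0 : ∀ x, 0 ≤ φ x) (h1 : ∫ x, φ x = 1) (huc : Continuous u) (hu : ∀ x, u x ≤ c)
    (x : Fin d → ℝ) : smoothing u φ 0 x ≤ c := by
  rw [smoothing_apply]
  calc ∫ t, u (x - t) * tensorDeriv φ 0 t ≤ ∫ t : Fin d → ℝ, c * tensorDeriv φ 0 t := by
        refine integral_mono (integrable_smoothing huc hφ hc 0 x)
          ((integrable_tensorDeriv hφ hc 0).const_mul c) fun t =>
            mul_le_mul_of_nonneg_right (hu _) ?_
        rw [tensorDeriv_zero_apply]
        exact Finset.prod_nonneg fun i _ => hφ0 _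
    _ = c := by rw [integral_const_mul, integral_tensorDeriv_zero h1, mul_one]

theorem smoothing_mem_Fkd {k : ℕ} {M δ L : ℝ} (hM : 1 ≤ M) (hδ : 0 < δ) (hδ1 : δ ≤ 1)
    (hφ : ContDiff ℝ ∞ φ) (hc : HasCompactSupport φ) (hφ0 : ∀ x, 0 ≤ φ x) (h1 : ∫ x, φ x = 1)
    (hφk : ∀ j ≤ k, ∫ x, |iteratedDeriv j φ x| ≤ (M / δ) ^ j)
    (huc : Continuous u) (hu0 : ∀ x, 0 ≤ u x) (hu1 : ∀ x, u x ≤ 1) (hL : 0 ≤ L)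
    (hLip : ∀ x i s, |u (x + s • Pi.single i 1) - u x| ≤ L * |s|)
    (hLk : L * (M / δ) ^ (k - 1) ≤ 1) (D : Set (Fin d → ℝ)) :
    smoothing u φ 0 ∈ Fkd k d D := by
  refine ⟨((contDiff_smoothing huc hφ hc 0).of_le (by exact_mod_cast le_top)).contDiffOn,
    fun α hα x _ => ?_⟩
  rw [mderiv]
  have hlen : ((List.finRange d).flatMap fun i => List.replicate (α i) i).length = ∑ i, α i := by
    simp [List.length_flatMap, List.sum_ofFn, ← List.ofFn_eq_map]
  revert hlen
  generalize ((List.finRange d).flatMap fun i => List.replicate (α i) i) = l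
  intro hlen
  rcases l with _ | ⟨i, l⟩
  · rw [List.foldr_nil, abs_of_nonneg (smoothing_zero_nonneg hφ0 hu0 x)]
    exact smoothing_zero_le hφ hc hφ0 h1 huc hu1 x
  · rw [List.foldr_cons, foldr_pderiv'_smoothing huc hφ hc]
    have hl : l.length ≤ k - 1 := by
      rw [List.length_cons] at hlen; omega
    refine (abs_pderiv'_smoothing_le huc hφ hc hL hLip _ i x).trans (le_trans ?_ hLk)
    refine mul_le_mul_of_nonneg_left ?_ hL
    calc ∏ j, ∫ t, |iteratedDeriv (l.count j) φ t|
        ≤ ∏ j, (M / δ) ^ l.count j := by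
          refine Finset.prod_le_prod (fun j _ => by positivity) fun j _ => hφk _ ?_
          have := List.count_le_length (a := j) (l := l)
          omega
      _ = (M / δ) ^ l.length := by
          have h := Multiset.sum_count_eq_card (s := Finset.univ) (m := (l : Multiset (Fin d)))
            fun j _ => Finset.mem_univ j
          rw [Finset.prod_pow_eq_pow_sum]
          simpa using congrArg ((M / δ) ^ ·) h
      _ ≤ (M / δ) ^ (k - 1) :=
          pow_le_pow_right₀ ((one_le_div hδ).2 (hδ1.trans hM)) hl

end Smoothing

/-- Truncation to `[0, 1]` is nonexpansive. -/
theorem abs_clamp_sub_clamp_le (a b : ℝ) :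
    |max 0 (min 1 a) - max 0 (min 1 b)| ≤ |a - b| :=
  (abs_max_sub_max_le_max _ _ _ _).trans
    (max_le (by simp) ((abs_min_sub_min_le_max _ _ _ _).trans (max_le (by simp) le_rfl)))

/-- A fooling function of height `η`: it vanishes at the nodes and equals `η` away from
`ℓ¹`-balls around them. -/
theorem exists_fooling {k d n : ℕ} (hk : 0 < k) (hd : 0 < d) (hn : 0 < n) {M δ η : ℝ} (hM : 1 ≤ M)
    (hδ : 0 < δ) (hδ1 : δ ≤ 1) (hη : 0 ≤ η) (hη1 : η ≤ 1) (hηM : η * M ^ k ≤ d * δ ^ k)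
    {φ : ℝ → ℝ} (hφ : ContDiff ℝ ∞ φ) (hc : HasCompactSupport φ)
    (hsupp : ∀ x, φ x ≠ 0 → |x| ≤ δ) (hφ0 : ∀ x, 0 ≤ φ x) (h1 : ∫ x, φ x = 1)
    (hφk : ∀ j ≤ k, ∫ x, |iteratedDeriv j φ x| ≤ (M / δ) ^ j) (p : Fin n → Fin d → ℝ) :
    ∃ f : (Fin d → ℝ) → ℝ, Continuous f ∧ (∀ D, f ∈ Fkd k d D) ∧ (∀ j, f (p j) = 0) ∧
      (∀ x, 0 ≤ f x) ∧ (∀ x, (∀ j, 3 * (d * δ) ≤ ∑ i, |x i - p j i|) → f x = η) := by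
  have hd' : (0 : ℝ) < d := by exact_mod_cast hd
  have hdδ : 0 < d * δ := mul_pos hd' hδ
  set P : Set (PiLp 1 fun _ : Fin d => ℝ) := Set.range fun j => WithLp.toLp 1 (p j) with hP
  have hPne : P.Nonempty := ⟨_, ⟨0, hn⟩, rfl⟩
  set ρ : (Fin d → ℝ) → ℝ := fun x => Metric.infDist (WithLp.toLp 1 x) P with hρ
  have hdist : ∀ x y : Fin d → ℝ, dist (WithLp.toLp 1 x) (WithLp.toLp 1 y) = ∑ i, |x i - y i| := by
    intro x y
    rw [PiLp.dist_eq_of_L1]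
    rfl
  have hρL : ∀ x y, |ρ x - ρ y| ≤ ∑ i, |x i - y i| := by
    intro x y
    rw [abs_sub_le_iff, ← hdist]
    constructor
    · rw [sub_le_iff_le_add']
      exact Metric.infDist_le_infDist_add_dist
    · rw [sub_le_iff_le_add', dist_comm]
      exact Metric.infDist_le_infDist_add_dist
  have hρc : Continuous ρ := (Metric.continuous_infDist_pt P).comp (PiLp.continuous_toLp 1 _)
  have hsmall : ∀ t : Fin d → ℝ, (∀ i, |t i| ≤ δ) → ∑ i, |t i| ≤ d * δ := fun t ht => by
    simpa using Finset.sum_le_card_nsmul Finset.univ (fun i => |t i|) δ fun i _ => ht i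
  have hshift : ∀ x t : Fin d → ℝ, (∀ i, |t i| ≤ δ) → |ρ (x - t) - ρ x| ≤ d * δ := fun x t ht =>
    (hρL _ _).trans (by simpa using hsmall t ht)
  set u : (Fin d → ℝ) → ℝ := fun x => η * max 0 (min 1 (ρ x / (d * δ) - 1)) with hu
  have huc : Continuous u := by fun_prop
  have hu0 : ∀ x, 0 ≤ u x := fun x => mul_nonneg hη (le_max_left _ _)
  have hu1 : ∀ x, u x ≤ 1 := fun x =>
    mul_le_one₀ hη1 (le_max_left _ _) (max_le zero_le_one (min_le_left _ _))
  have hLip : ∀ x i s, |u (x + s • Pi.single i 1) - u x| ≤ η / (d * δ) * |s| := by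
    intro x i s
    have h := hρL (x + s • Pi.single i 1) x
    have hsum : ∑ j, |(x + s • (Pi.single i 1 : Fin d → ℝ)) j - x j| = |s| := by
      rw [Finset.sum_eq_single i] <;> simp +contextual
    rw [hsum] at h
    rw [hu]
    simp only
    rw [← mul_sub, abs_mul, abs_of_nonneg hη, div_mul_eq_mul_div, mul_div_assoc]
    refine mul_le_mul_of_nonneg_left ((abs_clamp_sub_clamp_le _ _).trans ?_) hη
    rw [sub_sub_sub_cancel_right, ← sub_div, abs_div, abs_of_pos hdδ]
    gcongr
  refine ⟨smoothing u φ 0, (contDiff_smoothing huc hφ hc 0).continuous, fun D =>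
    smoothing_mem_Fkd hM hδ hδ1 hφ hc hφ0 h1 hφk huc hu0 hu1 (by positivity) hLip ?_ D,
    fun j => ?_, smoothing_zero_nonneg hφ0 hu0, fun x hx => ?_⟩
  · obtain ⟨m, rfl⟩ : ∃ m, k = m + 1 := ⟨k - 1, by omega⟩
    rw [Nat.add_sub_cancel, div_pow, div_mul_div_comm, div_le_one (by positivity)]
    calc η * M ^ m ≤ η * M ^ (m + 1) := by gcongr; simp
      _ ≤ d * δ ^ (m + 1) := hηM
      _ = d * δ * δ ^ m := by ring
  · refine smoothing_zero_eq_of_forall hsupp h1 fun t ht => ?_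
    have h0 : ρ (p j) = 0 := Metric.infDist_zero_of_mem ⟨j, rfl⟩
    have h2 := (abs_le.1 (hshift (p j) t ht)).2
    have h3 : ρ (p j - t) / (d * δ) ≤ 1 := (div_le_one hdδ).2 (by linarith)
    have h4 : min 1 (ρ (p j - t) / (d * δ) - 1) ≤ 0 := (min_le_right _ _).trans (by linarith)
    simp only [hu, max_eq_left h4, mul_zero]
  · refine smoothing_zero_eq_of_forall hsupp h1 fun t ht => ?_
    have h0 : 3 * (d * δ) ≤ ρ x := by
      refine (Metric.le_infDist hPne).2 ?_
      rintro _ ⟨j, rfl⟩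
      rw [hdist]
      exact hx j
    have h2 := (abs_le.1 (hshift x t ht)).1
    have h3 : 2 ≤ ρ (x - t) / (d * δ) := (le_div_iff₀ hdδ).2 (by linarith)
    have h4 : 1 ≤ ρ (x - t) / (d * δ) - 1 := by linarith
    simp only [hu, min_eq_left h4, max_eq_right zero_le_one, mul_one]

theorem volume_l1_ball_le {d : ℕ} (hd : 0 < d) {δ : ℝ} (hδ : 0 < δ) (p : Fin d → ℝ) :
    volume {x : Fin d → ℝ | ∑ i, |x i - p i| < 3 * (d * δ)} ≤
      ENNReal.ofReal ((6 * Real.exp 1 * δ) ^ d) := by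
  have : Nonempty (Fin d) := ⟨⟨0, hd⟩⟩
  have h := volume_sum_rpow_lt (ι := Fin d) (p := 1) le_rfl (3 * (d * δ))
  have htr : {x : Fin d → ℝ | ∑ i, |x i - p i| < 3 * (d * δ)} = (fun x => x + -p) ⁻¹'
      {x : Fin d → ℝ | (∑ i, |x i| ^ (1 : ℝ)) ^ (1 / (1 : ℝ)) < 3 * (d * δ)} := by
    ext x
    simp [sub_eq_add_neg]
  rw [htr, measure_preimage_add_right, h, ← ENNReal.ofReal_pow (by positivity),
    ← ENNReal.ofReal_mul (by positivity)]
  refine ENNReal.ofReal_le_ofReal ?_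
  have hΓ : Real.Gamma (1 / 1 + 1) = 1 := by norm_num
  have hΓd : Real.Gamma ((Fintype.card (Fin d) : ℝ) / 1 + 1) = d.factorial := by
    rw [div_one, Real.Gamma_nat_eq_factorial, Fintype.card_fin]
  rw [hΓ, hΓd, Fintype.card_fin]
  have he := Real.pow_div_factorial_le_exp (d : ℝ) (by positivity) d
  calc (3 * (d * δ)) ^ d * ((2 * 1) ^ d / d.factorial)
      = (6 * δ) ^ d * ((d : ℝ) ^ d / d.factorial) := by
        rw [← mul_div_assoc, ← mul_div_assoc, ← mul_pow, ← mul_pow]; ring_nf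
    _ ≤ (6 * δ) ^ d * Real.exp d := by gcongr
    _ = (6 * Real.exp 1 * δ) ^ d := by
        rw [← Real.exp_one_pow, ← mul_pow]; ring_nf

theorem volume_unitCube (d : ℕ) : volume (unitCube d) = 1 := by
  simp [unitCube, Real.volume_pi_Ioo]

theorem measurableSet_unitCube (d : ℕ) : MeasurableSet (unitCube d) :=
  MeasurableSet.univ_pi fun _ => measurableSet_Ioo

/-- A uniform lower bound for the integrals of fooling functions bounds the minimal error. -/
theorem le_interr {k d n : ℕ} {a : ℝ}
    (h : ∀ p : Fin n → Fin d → ℝ, ∃ f ∈ Fkd k d (unitCube d), (∀ j, f (p j) = 0) ∧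
      a ≤ ∫ t in unitCube d, f t) :
    a ≤ interr (unitCube d) (Fkd k d (unitCube d)) n := by
  have : Nonempty (unitCube d) :=
    ⟨⟨fun _ => 1 / 2, fun _ _ => ⟨by norm_num, by norm_num⟩⟩⟩
  refine le_ciInf fun x => ?_
  obtain ⟨f, hf, hf0, hfa⟩ := h fun j => x j
  refine hfa.trans (le_csSup ⟨1, ?_⟩ ⟨f, ⟨hf, hf0⟩, rfl⟩)
  rintro _ ⟨g, ⟨hg, -⟩, rfl⟩
  have hb : ∀ t ∈ unitCube d, ‖g t‖ ≤ 1 := fun t ht => by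
    have h0 : ((List.finRange d).flatMap fun i => List.replicate ((0 : Fin d → ℕ) i) i) = [] := by
      simp [List.flatMap_eq_nil_iff]
    have := hg.2 0 (by simp) t ht
    rwa [mderiv, h0] at this
  have := norm_setIntegral_le_of_norm_le_const (μ := volume)
    (by rw [volume_unitCube]; exact ENNReal.one_lt_top) hb
  simp only [Measure.real, volume_unitCube, ENNReal.toReal_one, mul_one] at this
  exact (le_abs_self _).trans this

theorem one_le_interr_zero (k d : ℕ) : 1 ≤ interr (unitCube d) (Fkd k d (unitCube d)) 0 := by
  refine le_interr fun p => ⟨fun _ => 1, ⟨contDiffOn_const, fun α _ x _ => ?_⟩,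
    fun j => j.elim0, ?_⟩
  · rw [mderiv]
    have h : ∀ l : List (Fin d), ∃ c : ℝ, |c| ≤ 1 ∧ l.foldr (pderiv' d) (fun _ => 1) = fun _ => c := by
      intro l
      induction l with
      | nil => exact ⟨1, by simp, rfl⟩
      | cons i l ih =>
        obtain ⟨c, -, hc⟩ := ih
        exact ⟨0, by simp, by rw [List.foldr_cons, hc]; funext y; simp [pderiv']⟩
    obtain ⟨c, hc, h⟩ := h ((List.finRange d).flatMap fun i => List.replicate (α i) i)
    rw [h]
    exact hc
  · simp [Measure.real, volume_unitCube]

/-- The integral over the cube of a nonnegative function that equals `η` off small `ℓ¹`-balls. -/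
theorem le_setIntegral_of_eq_off_balls {d n : ℕ} (hd : 0 < d) {δ η : ℝ} (hδ : 0 < δ) (hη : 0 ≤ η)
    (hvol : n * (6 * Real.exp 1 * δ) ^ d ≤ 1 / 4) {f : (Fin d → ℝ) → ℝ} (hfc : Continuous f)
    (hf0 : ∀ x, 0 ≤ f x) {p : Fin n → Fin d → ℝ}
    (hf : ∀ x, (∀ j, 3 * (d * δ) ≤ ∑ i, |x i - p j i|) → f x = η) :
    3 / 4 * η ≤ ∫ t in unitCube d, f t := by
  set B : Set (Fin d → ℝ) := ⋃ j, {x | ∑ i, |x i - p j i| < 3 * (d * δ)} with hB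
  have hBm : MeasurableSet B := MeasurableSet.iUnion fun j =>
    (isOpen_lt (by fun_prop) continuous_const).measurableSet
  have hBv : volume B ≤ ENNReal.ofReal (1 / 4) := by
    calc volume B ≤ ∑ j, volume {x : Fin d → ℝ | ∑ i, |x i - p j i| < 3 * (d * δ)} :=
          measure_iUnion_fintype_le _ _
      _ ≤ ∑ _j : Fin n, ENNReal.ofReal ((6 * Real.exp 1 * δ) ^ d) :=
          Finset.sum_le_sum fun j _ => volume_l1_ball_le hd hδ (p j)
      _ = ENNReal.ofReal (n * (6 * Real.exp 1 * δ) ^ d) := by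
          rw [ENNReal.ofReal_mul (by positivity)]; simp
      _ ≤ ENNReal.ofReal (1 / 4) := ENNReal.ofReal_le_ofReal hvol
  have hBr : volume.real B ≤ 1 / 4 := ENNReal.toReal_le_of_le_ofReal (by norm_num) hBv
  have hBfin : volume B ≠ ⊤ := (hBv.trans_lt ENNReal.ofReal_lt_top).ne
  have hcube : volume.real (unitCube d) = 1 := by simp [Measure.real, volume_unitCube]
  have hdiff : 3 / 4 ≤ volume.real (unitCube d \ B) := by
    have := le_measureReal_sdiff (μ := volume) (s₁ := unitCube d) (s₂ := B) hBfin
    linarith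
  have hint : IntegrableOn f (unitCube d) :=
    (hfc.integrableOn_Icc (a := 0) (b := 1)).mono_set fun x hx =>
      ⟨fun i => (hx i trivial).1.le, fun i => (hx i trivial).2.le⟩
  calc 3 / 4 * η ≤ volume.real (unitCube d \ B) * η := by gcongr
    _ = ∫ t in unitCube d \ B, f t := by
        rw [setIntegral_congr_fun (g := fun _ => η) ((measurableSet_unitCube d).diff hBm)]
        · simp
        · intro x hx
          refine hf x fun j => ?_
          by_contra! h
          exact hx.2 (Set.mem_iUnion.2 ⟨j, h⟩)
    _ ≤ ∫ t in unitCube d, f t :=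
        setIntegral_mono_set hint (.of_forall hf0) (.of_forall Set.sdiff_subset)

/-- For every `k` there is `c_k > 0` such that for all `d ≥ 1` and `ε ∈ (0, 1/2)` the
information complexity of integration on `F^k_d` is at least `(c_k d / ε)^{d/k}`:
any `n` achieving error at most `ε` satisfies `n ≥ (c_k d / ε)^{d/k}`. -/
theorem complexity_lower_bound_Fkd (k : ℕ) (hk : 0 < k) :
    ∃ c : ℝ, 0 < c ∧ ∀ d : ℕ, 0 < d → ∀ ε : ℝ, ε ∈ Set.Ioo (0 : ℝ) (1 / 2) →
      ∀ n : ℕ, interr (unitCube d) (Fkd k d (unitCube d)) n ≤ ε →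
        (c * d / ε) ^ ((d : ℝ) / k) ≤ (n : ℝ) := by
  obtain ⟨M, hM, hker⟩ := exists_kernel k
  have hM0 : 0 < M := by linarith
  have he : 0 < Real.exp 1 := Real.exp_pos 1
  set A : ℝ := 24 * Real.exp 1 * M with hA
  have hA0 : 0 < A := by positivity
  refine ⟨(2 * A ^ k)⁻¹, by positivity, fun d hd ε ⟨hε0, hε1⟩ n hn => ?_⟩
  by_contra! hlt
  have hd' : (0 : ℝ) < d := by exact_mod_cast hd
  have hk' : (k : ℝ) ≠ 0 := by exact_mod_cast hk.ne'
  rcases Nat.eq_zero_or_pos n with rfl | hn0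
  · linarith [one_le_interr_zero k d]
  have hn1 : (1 : ℝ) ≤ n := by exact_mod_cast hn0
  set q : ℝ := (2 * A ^ k)⁻¹ * d / ε with hq
  have hq0 : 0 < q := by positivity
  set s : ℝ := q ^ ((1 : ℝ) / k) with hs
  have hs0 : 0 < s := Real.rpow_pos_of_pos hq0 _
  have hsk : s ^ k = q := by
    rw [hs, ← Real.rpow_natCast, ← Real.rpow_mul hq0.le, one_div_mul_cancel hk', Real.rpow_one]
  have hsd : q ^ ((d : ℝ) / k) = s ^ d := by
    rw [hs, ← Real.rpow_natCast, ← Real.rpow_mul hq0.le]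
    congr 1
    ring
  rw [hsd] at hlt
  have hs1 : 1 < s := by
    by_contra! h
    linarith [pow_le_one₀ (n := d) hs0.le h]
  set δ : ℝ := (24 * Real.exp 1 * s)⁻¹ with hδdef
  have hδ0 : 0 < δ := by positivity
  have hδ1 : δ ≤ 1 := by
    refine inv_le_one_of_one_le₀ ?_
    nlinarith [Real.add_one_le_exp (1 : ℝ)]
  have hηM : 2 * ε * M ^ k ≤ d * δ ^ k := by
    refine le_of_eq ?_
    rw [hδdef, inv_pow, mul_pow, hsk, hq, hA, mul_pow _ M]
    field_simp
  have hvol : n * (6 * Real.exp 1 * δ) ^ d ≤ 1 / 4 := by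
    have h6 : 6 * Real.exp 1 * δ = 1 / 4 * s⁻¹ := by
      rw [hδdef]
      field_simp
      norm_num
    calc n * (6 * Real.exp 1 * δ) ^ d ≤ s ^ d * (6 * Real.exp 1 * δ) ^ d := by gcongr
      _ = (1 / 4) ^ d := by
          rw [h6, ← mul_pow]
          congr 1
          field_simp
      _ ≤ 1 / 4 := pow_le_of_le_one (by norm_num) (by norm_num) hd.ne'
  obtain ⟨φ, hφ, hc, hsupp, hφ0, h1, hφk⟩ := hker δ hδ0
  have hlow : 3 / 4 * (2 * ε) ≤ interr (unitCube d) (Fkd k d (unitCube d)) n := by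
    refine le_interr fun p => ?_
    obtain ⟨f, hfc, hfF, hfp, hf0, hfη⟩ := exists_fooling hk hd hn0 hM hδ0 hδ1
      (η := 2 * ε) (by linarith) (by linarith) hηM hφ hc hsupp hφ0 h1 hφk p
    exact ⟨f, hfF _, hfp,
      le_setIntegral_of_eq_off_balls hd hδ0 (by linarith) hvol hfc hf0 hfη⟩
  linarith
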